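/- If $n=2m+1>13$ and $Q_{4m}(z)=(2m+1)z^{2m}+\sum_{j=1}^{2m}b_j(z^{2m-j}+z^{2m+j})$ where $b_j\in\{-1,0,1\}$ for even $j$ and $4\mid b_j$ for odd $j$, then there is no $P\in\mathcal{L}_{2m}$ with $Q_{4m}(z)=P(z)P^*(z)$. -/

import Mathlib

open Finset Polynomial

lemma neg_one_pow_sub_of_even {r i : ℕ} (hr : Even r) (hir : i ≤ r) :
    (-1 : ℤ) ^ (r - i) = (-1) ^ i := by
  rcases Nat.even_or_odd i with hi | hi
  · rw [hi.neg_one_pow, Even.neg_one_pow (by grind)]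
  · rw [hi.neg_one_pow, Odd.neg_one_pow (by grind)]

/-- Modulo two, a sum symmetric about its midpoint reduces to the middle term. -/
lemma even_sum_Ioo_add_middle (f : ℕ → ℤ) (k : ℕ) (hk : 1 ≤ k)
    (hf : ∀ i ∈ Ioo 0 (2 * k), f (2 * k - i) = f i) :
    Even (∑ i ∈ Ioo 0 (2 * k), f i + f k) := by
  have hmem : k ∈ Ioo 0 (2 * k) := by simp; omega
  have hcancel : ∑ i ∈ (Ioo 0 (2 * k)).erase k, ((f i : ℤ) : ZMod 2) = 0 := by
    refine Finset.sum_involution (fun i _ => 2 * k - i) ?_ ?_ ?_ ?_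
    · intro i hi
      rw [hf i (mem_of_mem_erase hi)]
      exact CharTwo.add_self_eq_zero _
    · intro i hi _
      simp only [mem_erase, mem_Ioo] at hi
      omega
    · intro i hi
      simp only [mem_erase, mem_Ioo] at hi ⊢
      omega
    · intro i hi
      simp only [mem_erase, mem_Ioo] at hi
      omega
  rw [← add_sum_erase _ _ hmem, ← ZMod.intCast_eq_zero_iff_even]
  push_cast
  rw [hcancel, add_zero]
  exact CharTwo.add_self_eq_zero _

section DifferenceSequence

variable {h : ℕ → ℤ} {m : ℕ}

lemma eq_zero_iff_double_eq_zero
    (hval : ∀ i, 1 ≤ i → i ≤ 2 * m → h i = 0 ∨ h i = 1 ∨ h i = -1)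
    (hconv : ∀ r, Even r → 2 ≤ r → r < 2 * m →
      h r + ∑ i ∈ Ioo 0 r, (-1) ^ i * h i * h (r - i) = 0)
    {k : ℕ} (hk : 1 ≤ k) (hkm : k < m) : h (2 * k) = 0 ↔ h k = 0 := by
  have hpar := even_sum_Ioo_add_middle (fun i => (-1) ^ i * h i * h (2 * k - i)) k hk (by
    intro i hi
    simp only [mem_Ioo] at hi
    have hsub : 2 * k - (2 * k - i) = i := by omega
    simp only [neg_one_pow_sub_of_even (even_two_mul k) hi.2.le, hsub]
    ring)
  have hc := hconv (2 * k) (even_two_mul k) (by omega) (by omega)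
  have hkk : 2 * k - k = k := by omega
  simp only [hkk] at hpar
  have hs : ∑ i ∈ Ioo 0 (2 * k), (-1) ^ i * h i * h (2 * k - i) = -h (2 * k) := by linarith
  rw [hs] at hpar
  rcases hval k hk (by omega) with a | a | a <;>
    rcases hval (2 * k) (by omega) (by omega) with b | b | b <;>
    rcases neg_one_pow_eq_or ℤ k with c | c <;>
    simp [a, b, c] at hpar ⊢

/-- Up to `2 * m - p`, the support consists of multiples of its least element `p`. -/
lemma dvd_of_ne_zero_of_least
    (hval : ∀ i, 1 ≤ i → i ≤ 2 * m → h i = 0 ∨ h i = 1 ∨ h i = -1)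
    (hconv : ∀ r, Even r → 2 ≤ r → r < 2 * m →
      h r + ∑ i ∈ Ioo 0 r, (-1) ^ i * h i * h (r - i) = 0)
    {p : ℕ} (hpodd : Odd p) (hp : h p ≠ 0) (hmin : ∀ i, 1 ≤ i → i < p → h i = 0)
    {q : ℕ} (hq1 : 1 ≤ q) (hqm : p + q < 2 * m) (hq : h q ≠ 0) : p ∣ q := by
  induction q using Nat.strong_induction_on with
  | _ q ih =>
  by_contra hpq
  have hlow : ∀ i, 1 ≤ i → i < q → h i ≠ 0 → p ∣ i := fun i hi hiq hne =>
    ih i hiq hi (by omega) hne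
  have hpq' : p < q := by
    rcases lt_trichotomy p q with hlt | heq | hgt
    · exact hlt
    · exact absurd heq.dvd hpq
    · exact absurd (hmin q hq1 hgt) hq
  have hppos := hpodd.pos
  have heven : ∀ i, Even i → 1 ≤ i → i < 2 * q → i < 2 * m → h i ≠ 0 → p ∣ i := by
    rintro i ⟨k, rfl⟩ hi hiq him hne
    have hk : h k ≠ 0 := by
      rw [← two_mul] at hne
      exact (eq_zero_iff_double_eq_zero hval hconv (by omega) (by omega)).not.mp hne
    exact dvd_add (hlow k (by omega) (by omega) hk) (hlow k (by omega) (by omega) hk)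
  have hqodd : Odd q := by
    rw [← Nat.not_even_iff_odd]
    exact fun he => hpq (heven q he hq1 (by omega) (by omega) hq)
  have hr : h (p + q) = 0 := by
    by_contra hne
    exact hpq ((Nat.dvd_add_right dvd_rfl).mp
      (heven _ (hpodd.add_odd hqodd) (by omega) (by omega) hqm hne))
  have hsum : ∑ i ∈ Ioo 0 (p + q), (-1) ^ i * h i * h (p + q - i) =
      ∑ i ∈ {p, q}, (-1) ^ i * h i * h (p + q - i) := by
    symm
    apply Finset.sum_subset
    · intro i hi
      simp only [mem_insert, mem_singleton] at hi
      simp only [mem_Ioo]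
      omega
    · intro i hi hni
      simp only [mem_Ioo] at hi
      simp only [mem_insert, mem_singleton, not_or] at hni
      by_contra hne
      have hi0 : h i ≠ 0 := fun h0 => hne (by rw [h0]; ring)
      have hj0 : h (p + q - i) ≠ 0 := fun h0 => hne (by rw [h0]; ring)
      have hip : p ≤ i := by
        by_contra hlt
        exact hi0 (hmin i hi.1 (by omega))
      have hjp : p ≤ p + q - i := by
        by_contra hlt
        exact hj0 (hmin _ (by omega) (by omega))
      have d1 := hlow i hi.1 (by omega) hi0
      have d2 := hlow (p + q - i) (by omega) (by omega) hj0
      have d3 : p ∣ p + q := by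
        have := dvd_add d1 d2
        rwa [Nat.add_sub_cancel' hi.2.le] at this
      exact hpq ((Nat.dvd_add_right dvd_rfl).mp d3)
  have hc := hconv (p + q) (hpodd.add_odd hqodd) (by omega) hqm
  rw [hsum, hr, sum_pair hpq'.ne, hpodd.neg_one_pow, hqodd.neg_one_pow, Nat.add_sub_cancel_left,
    Nat.add_sub_cancel] at hc
  have : h p * h q = 0 := by linarith
  simp_all

lemma not_exists_difference_sequence (hm : 7 ≤ m) (h1 : h 1 = 0)
    (hval : ∀ i, 1 ≤ i → i ≤ 2 * m → h i = 0 ∨ h i = 1 ∨ h i = -1)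
    (hrefl : ∀ i, 1 ≤ i → i ≤ 2 * m → h i = 0 → h (2 * m + 1 - i) ≠ 0)
    (hconv : ∀ r, Even r → 2 ≤ r → r < 2 * m →
      h r + ∑ i ∈ Ioo 0 r, (-1) ^ i * h i * h (r - i) = 0) : False := by
  have hdouble := fun k => @eq_zero_iff_double_eq_zero h m hval hconv k
  have hex : ∃ i, 1 ≤ i ∧ i ≤ m ∧ h i ≠ 0 := by
    by_contra! hall
    have h3 := hrefl 3 (by omega) (by omega) (hall 3 (by omega) (by omega))
    rw [show 2 * m + 1 - 3 = 2 * (m - 1) by omega] at h3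
    exact h3 ((hdouble _ (by omega) (by omega)).mpr (hall _ (by omega) (by omega)))
  classical
  obtain ⟨p, ⟨hp1, hpm, hp⟩, hpmin⟩ :
      ∃ p, (1 ≤ p ∧ p ≤ m ∧ h p ≠ 0) ∧ ∀ i < p, ¬ (1 ≤ i ∧ i ≤ m ∧ h i ≠ 0) :=
    ⟨Nat.find hex, Nat.find_spec hex, fun _ => Nat.find_min hex⟩
  have hmin : ∀ i, 1 ≤ i → i < p → h i = 0 := fun i hi hip => by
    by_contra hne
    exact hpmin i hip ⟨hi, by omega, hne⟩
  have hpodd : Odd p := by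
    rw [← Nat.not_even_iff_odd]
    rintro ⟨k, rfl⟩
    rw [← two_mul] at hp
    exact hp ((hdouble k (by omega) (by omega)).mpr (hmin k (by omega) (by omega)))
  have hp_ne_one : p ≠ 1 := by
    rintro rfl
    exact hp h1
  have hdvd : ∀ q, 1 ≤ q → p + q < 2 * m → h q ≠ 0 → p ∣ q := fun q =>
    dvd_of_ne_zero_of_least hval hconv hpodd hp hmin
  have key : ∀ k, p + 1 < 2 * k → k < m → ¬ p ∣ 2 * k → p ∣ 2 * m + 1 - 2 * k := by
    intro k hk hkm hpk
    have hzero : h (2 * k) = 0 := by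
      rw [hdouble k (by omega) hkm]
      by_contra hne
      exact hpk ((hdvd k (by omega) (by omega) hne).mul_left 2)
    exact hdvd _ (by omega) (by omega) (hrefl _ (by omega) (by omega) hzero)
  obtain ⟨t, rfl⟩ := hpodd
  rcases (by omega : t = 1 ∨ t = 2 ∨ 3 ≤ t) with rfl | rfl | ht
  · have h8 := key 4 (by omega) (by omega) (by omega)
    have h10 := key 5 (by omega) (by omega) (by omega)
    omega
  · have h8 := key 4 (by omega) (by omega) (by omega)
    have h12 := key 6 (by omega) (by omega) (by omega)
    omega
  · have hnd : ∀ s, 1 ≤ s → s < 2 * t + 1 → ¬ (2 * t + 1) ∣ (2 * t + 1) + s := by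
      intro s hs hst hd
      have := Nat.le_of_dvd hs ((Nat.dvd_add_right dvd_rfl).mp hd)
      omega
    have ha := key (t + 2) (by omega) (by omega) (by
      rw [show 2 * (t + 2) = (2 * t + 1) + 3 by ring]
      exact hnd 3 (by omega) (by omega))
    have hb := key (t + 3) (by omega) (by omega) (by
      rw [show 2 * (t + 3) = (2 * t + 1) + 5 by ring]
      exact hnd 5 (by omega) (by omega))
    have hd := Nat.dvd_sub ha hb
    rw [show 2 * m + 1 - 2 * (t + 2) - (2 * m + 1 - 2 * (t + 3)) = 2 by omega] at hd
    have := Nat.le_of_dvd (by omega) hd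
    omega

end DifferenceSequence

/-- The first differences of a sequence whose alternating self-convolution is `1` at even
indices have vanishing alternating self-convolution at positive even indices. -/
lemma sum_difference_eq_zero (x : ℕ → ℤ) (m : ℕ)
    (hconv : ∀ r, Even r → r < 2 * m →
      ∑ i ∈ range (r + 1), (-1) ^ i * x i * x (r - i) = 1)
    (g : ℕ → ℤ) (hg0 : g 0 = x 0) (hg : ∀ i, g (i + 1) = x (i + 1) - x i)
    (r : ℕ) (hr : Even r) (hr2 : 2 ≤ r) (hrm : r < 2 * m) :
    ∑ i ∈ range (r + 1), (-1) ^ i * g i * g (r - i) = 0 := by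
  have hG : PowerSeries.mk g = (1 - PowerSeries.X) * PowerSeries.mk x := by
    ext i
    cases i with
    | zero => simp [hg0, sub_mul]
    | succ i => simp [hg, sub_mul, PowerSeries.coeff_succ_X_mul]
  have hG' : PowerSeries.mk (fun i => (-1) ^ i * g i) =
      (1 + PowerSeries.X) * PowerSeries.mk (fun i => (-1) ^ i * x i) := by
    ext i
    cases i with
    | zero => simp [hg0, add_mul]
    | succ i =>
      simp [hg, add_mul, PowerSeries.coeff_succ_X_mul]
      ring
  have hprod : PowerSeries.mk (fun i => (-1) ^ i * g i) * PowerSeries.mk g =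
      PowerSeries.mk (fun i => (-1) ^ i * x i) * PowerSeries.mk x -
      PowerSeries.X ^ 2 * (PowerSeries.mk (fun i => (-1) ^ i * x i) * PowerSeries.mk x) := by
    rw [hG, hG']
    ring
  have hcoeff := congrArg (PowerSeries.coeff r) hprod
  obtain ⟨s, rfl⟩ : ∃ s, r = s + 2 := ⟨r - 2, by omega⟩
  have hs : Even s := by grind
  rw [map_sub, PowerSeries.coeff_X_pow_mul] at hcoeff
  simp only [PowerSeries.coeff_mul, PowerSeries.coeff_mk,
    Finset.Nat.sum_antidiagonal_eq_sum_range_succ_mk] at hcoeff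
  rw [hcoeff, hconv _ hr hrm, hconv s hs (by omega), sub_self]

lemma not_exists_sign_sequence_of_eq_one {x : ℕ → ℤ} {m : ℕ} (hm : 7 ≤ m)
    (hx : ∀ i ≤ 2 * m, x i = 1 ∨ x i = -1) (hx0 : x 0 = 1) (hx1 : x 1 = 1)
    (hrefl : ∀ i ≤ 2 * m, x i * x (2 * m - i) = (-1) ^ (m + i))
    (hconv : ∀ r, Even r → r < 2 * m →
      ∑ i ∈ range (r + 1), (-1) ^ i * x i * x (r - i) = 1) : False := by
  let h : ℕ → ℤ := fun i => (x i - x (i - 1)) / 2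
  have hh : ∀ i, 1 ≤ i → i ≤ 2 * m → 2 * h i = x i - x (i - 1) := by
    intro i hi him
    simp only [h]
    rcases hx i him with a | a <;> rcases hx (i - 1) (by omega) with b | b <;> simp [a, b]
  let g : ℕ → ℤ := fun i => if i = 0 then x 0 else x i - x (i - 1)
  have hgh : ∀ i, 1 ≤ i → i ≤ 2 * m → g i = 2 * h i := by
    intro i hi him
    rw [hh i hi him]
    simp [g, show i ≠ 0 by omega]
  refine not_exists_difference_sequence (h := h) hm ?_ ?_ ?_ ?_
  · simp [h, hx0, hx1]
  · intro i hi him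
    have := hh i hi him
    rcases hx i him with a | a <;> rcases hx (i - 1) (by omega) with b | b <;>
      rw [a, b] at this <;> omega
  · intro i hi him hzero hzero'
    have e1 := hh i hi him
    have e2 := hh (2 * m + 1 - i) (by omega) (by omega)
    rw [show 2 * m + 1 - i - 1 = 2 * m - i by omega] at e2
    have r1 := hrefl i him
    have r2 := hrefl (i - 1) (by omega)
    rw [show 2 * m - (i - 1) = 2 * m + 1 - i by omega] at r2
    have e3 : x (i - 1) = x i := by linarith
    have e4 : x (2 * m + 1 - i) = x (2 * m - i) := by linarith
    rw [e3, e4, r1] at r2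
    rw [show m + i = m + (i - 1) + 1 by omega, pow_succ] at r2
    rcases neg_one_pow_eq_or ℤ (m + (i - 1)) with c | c <;> rw [c] at r2 <;> norm_num at r2
  · intro r hr hr2 hrm
    have hs := sum_difference_eq_zero x m hconv g (by simp [g]) (by simp [g]) r hr hr2 hrm
    have hrange : range (r + 1) = insert 0 (insert r (Ioo 0 r)) := by
      ext i
      simp only [mem_range, mem_insert, mem_Ioo]
      omega
    have hinner : ∑ i ∈ Ioo 0 r, (-1) ^ i * g i * g (r - i) =
        4 * ∑ i ∈ Ioo 0 r, (-1) ^ i * h i * h (r - i) := by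
      rw [Finset.mul_sum]
      refine Finset.sum_congr rfl fun i hi => ?_
      simp only [mem_Ioo] at hi
      rw [hgh i (by omega) (by omega), hgh (r - i) (by omega) (by omega)]
      ring
    have hg0 : g 0 = 1 := by simp [g, hx0]
    rw [hrange, sum_insert (by simp; omega), sum_insert (by simp), hinner, hr.neg_one_pow,
      Nat.sub_self, Nat.sub_zero, hg0, hgh r (by omega) (by omega)] at hs
    linarith

lemma not_exists_sign_sequence {x : ℕ → ℤ} {m : ℕ} (hm : 7 ≤ m)
    (hx : ∀ i ≤ 2 * m, x i = 1 ∨ x i = -1)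
    (hrefl : ∀ i ≤ 2 * m, x i * x (2 * m - i) = (-1) ^ (m + i))
    (hconv : ∀ r, Even r → r < 2 * m →
      ∑ i ∈ range (r + 1), (-1) ^ i * x i * x (r - i) = 1) : False := by
  have hs0 := hx 0 (by omega)
  have hs1 := hx 1 (by omega)
  obtain ⟨s, hs⟩ : ∃ s, s = x 0 := ⟨_, rfl⟩
  obtain ⟨e, he⟩ : ∃ e, e = x 0 * x 1 := ⟨_, rfl⟩
  have hss : s * s = 1 := by rcases hs0 with a | a <;> simp [hs, a]
  have hee : e = 1 ∨ e = -1 := by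
    rcases hs0 with a | a <;> rcases hs1 with c | c <;> simp [he, a, c]
  have hepow : ∀ r, Even r → e ^ r = 1 := by
    intro r hr
    rcases hee with a | a <;> simp [a, hr.neg_one_pow]
  have htwist : ∀ i j, Even (i + j) →
      (s * e ^ i * x i) * (s * e ^ j * x j) = x i * x j := by
    intro i j hij
    calc (s * e ^ i * x i) * (s * e ^ j * x j) = (s * s) * e ^ (i + j) * (x i * x j) := by ring
      _ = x i * x j := by rw [hss, hepow _ hij]; ring
  refine not_exists_sign_sequence_of_eq_one (x := fun i => s * e ^ i * x i) hm ?_ ?_ ?_ ?_ ?_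
  · intro i hi
    have hei : e ^ i = 1 ∨ e ^ i = -1 := by
      rcases hee with a | a
      · simp [a]
      · rw [a]
        exact neg_one_pow_eq_or ℤ i
    rcases hs0 with a | a <;> rcases hei with c | c <;> rcases hx i hi with d | d <;>
      simp [hs, a, c, d]
  · simpa [← hs] using hss
  · rcases hs0 with a | a <;> rcases hs1 with c | c <;> simp [hs, he, a, c]
  · intro i hi
    rw [htwist _ _ (by rw [Nat.add_sub_cancel' hi]; exact even_two_mul m)]
    exact hrefl i hi
  · intro r hr hrm
    refine (Finset.sum_congr rfl fun i hi => ?_).trans (hconv r hr hrm)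
    have hir : i ≤ r := by simpa [Nat.lt_succ_iff] using hi
    have := htwist i (r - i) (by rwa [Nat.add_sub_cancel' hir])
    linear_combination (-1) ^ i * this

lemma aperiodic_autocorrelation_modEq {x : ℕ → ℤ} {k l : ℕ}
    (hx : ∀ i < k + l, x i = 1 ∨ x i = -1) :
    ∑ i ∈ range l, x i * x (i + k) ≡
      ∑ i ∈ range l, x i + (∑ i ∈ range (k + l), x i - ∑ i ∈ range k, x i) - l [ZMOD 4] := by
  have hshift : ∑ i ∈ range l, x (i + k) = ∑ i ∈ range (k + l), x i - ∑ i ∈ range k, x i := by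
    rw [Finset.sum_range_add]
    simp [add_comm]
  have hl : (l : ℤ) = ∑ i ∈ range l, (1 : ℤ) := by simp
  rw [← hshift, hl, ← Finset.sum_add_distrib, ← Finset.sum_sub_distrib]
  apply Int.ModEq.symm
  rw [Int.modEq_iff_dvd, ← Finset.sum_sub_distrib]
  refine Finset.dvd_sum fun i hi => ?_
  simp only [mem_range] at hi
  rcases hx i (by omega) with a | a <;> rcases hx (i + k) (by omega) with c | c <;> simp [a, c]

lemma eq_sum_of_eq_mul_reflect {P : ℤ[X]} {m : ℕ} {c : ℤ} {b : ℕ → ℤ}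
    (hP : C c * X ^ (2 * m) +
      ∑ j ∈ Icc 1 (2 * m), C (b j) * (X ^ (2 * m - j) + X ^ (2 * m + j)) =
        P * Polynomial.reflect (2 * m) P) {k l : ℕ} (hk : 1 ≤ k) (hkl : k + l = 2 * m + 1)
    (hl : 1 ≤ l) : b k = ∑ i ∈ range l, P.coeff i * P.coeff (i + k) := by
  have hcoeff := congrArg (fun p => coeff p (2 * m - k)) hP
  simp only [coeff_add, finsetSum_coeff, coeff_C_mul, coeff_X_pow] at hcoeff
  rw [coeff_mul, Finset.Nat.sum_antidiagonal_eq_sum_range_succ_mk] at hcoeff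
  simp only [coeff_reflect] at hcoeff
  rw [Finset.sum_eq_single k, if_neg (by omega), if_pos rfl, if_neg (by omega)] at hcoeff
  · rw [show (2 * m - k).succ = l by omega] at hcoeff
    simp only [mul_zero, zero_add, add_zero, mul_one] at hcoeff
    rw [hcoeff]
    refine Finset.sum_congr rfl fun i hi => ?_
    simp only [mem_range] at hi
    rw [revAt_le (by omega), show 2 * m - (2 * m - k - i) = i + k by omega]
  · intro j hj hjk
    simp only [mem_Icc] at hj
    rw [if_neg (by omega), if_neg (by omega)]
    ring
  · intro hk'
    simp only [mem_Icc] at hk'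
    omega

theorem stmt16 (m n : ℕ) (hn : n = 2 * m + 1) (h13 : 13 < n) (b : ℕ → ℤ)
    (hbeven : ∀ j, 1 ≤ j → j ≤ 2 * m → Even j → b j = -1 ∨ b j = 0 ∨ b j = 1)
    (hbodd : ∀ j, 1 ≤ j → j ≤ 2 * m → Odd j → (4 : ℤ) ∣ b j) :
    ¬ ∃ P : Polynomial ℤ, P.natDegree = 2 * m ∧
      (∀ i ≤ 2 * m, P.coeff i = 1 ∨ P.coeff i = -1) ∧
      C ((2 * m + 1 : ℤ)) * X ^ (2 * m) +
          ∑ j ∈ Icc 1 (2 * m), C (b j) * (X ^ (2 * m - j) + X ^ (2 * m + j)) =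
        P * Polynomial.reflect (2 * m) P := by
  rintro ⟨P, -, hx, hP⟩
  obtain ⟨x, hxdef⟩ : ∃ x : ℕ → ℤ, x = P.coeff := ⟨_, rfl⟩
  have hb : ∀ k l, 1 ≤ k → 1 ≤ l → k + l = 2 * m + 1 →
      b k = ∑ i ∈ range l, x i * x (i + k) := fun k l hk hl hkl => by
    rw [hxdef]
    exact eq_sum_of_eq_mul_reflect hP hk hkl hl
  rw [← hxdef] at hx
  obtain ⟨S, hS⟩ : ∃ S : ℕ → ℤ, S = fun k => ∑ i ∈ range k, x i := ⟨_, rfl⟩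
  have hmod : ∀ k l, 1 ≤ k → 1 ≤ l → k + l = 2 * m + 1 →
      b k ≡ S l + (S (2 * m + 1) - S k) - l [ZMOD 4] := by
    intro k l hk hl hkl
    rw [hb k l hk hl hkl, hS, ← hkl]
    exact aperiodic_autocorrelation_modEq fun i hi => hx i (by omega)
  have hSodd : (2 : ℤ) ∣ S (2 * m + 1) - (2 * m + 1) := by
    have hcard : (2 * m + 1 : ℤ) = ∑ i ∈ range (2 * m + 1), (1 : ℤ) := by simp
    rw [hcard, hS, ← Finset.sum_sub_distrib]
    refine Finset.dvd_sum fun i hi => ?_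
    simp only [mem_range] at hi
    rcases hx i (by omega) with a | a <;> simp [a]
  have heven : ∀ k, 1 ≤ k → k ≤ 2 * m → Even k → b k = (-1) ^ m := by
    intro k hk hkm hke
    have h1 := hmod k (2 * m + 1 - k) hk (by omega) (by omega)
    have h2 := hmod (2 * m + 1 - k) k (by omega) hk (by omega)
    have h3 := hbodd (2 * m + 1 - k) (by omega) (by omega) (by grind)
    have h4 := hbeven k hk hkm hke
    rw [Int.ModEq] at h1 h2
    rcases Nat.even_or_odd m with hm | hm
    · rw [hm.neg_one_pow]
      obtain ⟨t, rfl⟩ := hm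
      omega
    · rw [hm.neg_one_pow]
      obtain ⟨t, rfl⟩ := hm
      omega
  have hrefl : ∀ i ≤ 2 * m, x i * x (2 * m - i) = (-1) ^ (m + i) := by
    have hends : x 0 * x (2 * m) = (-1) ^ m := by
      rw [← heven (2 * m) (by omega) le_rfl (even_two_mul m), hb (2 * m) 1 (by omega) le_rfl rfl]
      simp
    intro i hi
    rcases Nat.eq_zero_or_pos i with rfl | hi0
    · simpa using hends
    rcases hi.eq_or_lt with rfl | hi'
    · rw [Nat.sub_self, mul_comm, hends, pow_add, (even_two_mul m).neg_one_pow, mul_one]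
    have h1 := hmod i (2 * m - i + 1) hi0 (by omega) (by omega)
    have h2 := hmod (i + 1) (2 * m - i) (by omega) (by omega) (by omega)
    have hS1 : ∀ k, S (k + 1) = S k + x k := fun k => by rw [hS]; exact sum_range_succ _ _
    rw [hS1 (2 * m - i), Int.ModEq] at h1
    rw [hS1 i, Int.ModEq] at h2
    have hxi := hx i hi
    have hxj := hx (2 * m - i) (by omega)
    rw [pow_add]
    rcases Nat.even_or_odd i with hie | hio
    · have h3 := heven i hi0 hi hie
      have h4 := hbodd (i + 1) (by omega) (by omega) hie.add_one
      rw [hie.neg_one_pow]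
      rcases neg_one_pow_eq_or ℤ m with c | c <;> rw [c] at h3 ⊢ <;>
        rcases hxi with d | d <;> rcases hxj with f | f <;> rw [d, f] <;> omega
    · have h3 := heven (i + 1) (by omega) (by omega) hio.add_one
      have h4 := hbodd i (by omega) (by omega) hio
      rw [hio.neg_one_pow]
      rcases neg_one_pow_eq_or ℤ m with c | c <;> rw [c] at h3 ⊢ <;>
        rcases hxi with d | d <;> rcases hxj with f | f <;> rw [d, f] <;> omega
  refine not_exists_sign_sequence (by omega) hx hrefl fun r hr hrm => ?_
  have h1 := heven (2 * m - r) (by omega) (by omega) (by grind)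
  rw [hb (2 * m - r) (r + 1) (by omega) (by omega) (by omega)] at h1
  rw [← mul_right_inj' (pow_ne_zero m (show (-1 : ℤ) ≠ 0 by norm_num)), mul_one]
  refine Eq.trans ?_ h1
  rw [Finset.mul_sum]
  refine Finset.sum_congr rfl fun i hi => ?_
  have hir : i ≤ r := by simpa [Nat.lt_succ_iff] using hi
  have h2 := hrefl (r - i) (by omega)
  rw [show i + (2 * m - r) = 2 * m - (r - i) by omega]
  rw [pow_add, neg_one_pow_sub_of_even hr hir] at h2
  have hxx : x (r - i) * x (r - i) = 1 := by
    rcases hx (r - i) (by omega) with c | c <;> simp [c]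
  linear_combination x i * x (2 * m - (r - i)) * hxx - x i * x (r - i) * h2
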